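/- Let L be a nilpotent symplectic alternating algebra. Then for every i ≥ 1, dim L^i − dim L^{i+1} = dim Z_i(L) − dim Z_{i−1}(L). -/

import Mathlib

/-- A symplectic alternating algebra structure on an `F`-vector space `L`:
a nondegenerate alternating bilinear form together with an alternating
bilinear product satisfying `(x·y, z) = (y·z, x)`. -/
structure SAAStruct (F : Type*) [Field F] (L : Type*) [AddCommGroup L] [Module F L] where
  form : L →ₗ[F] L →ₗ[F] F
  mul : L →ₗ[F] L →ₗ[F] L
  form_alt : ∀ x : L, form x x = 0
  form_nondegen : ∀ x : L, (∀ y : L, form x y = 0) → x = 0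
  mul_alt : ∀ x : L, mul x x = 0
  cyclic : ∀ x y z : L, form (mul x y) z = form (mul y z) x

namespace SAAStruct

variable {F : Type*} [Field F] {L : Type*} [AddCommGroup L] [Module F L]

/-- `I` is an ideal of the symplectic alternating algebra `A`. -/
def IsIdealSub (A : SAAStruct F L) (I : Submodule F L) : Prop :=
  ∀ x ∈ I, ∀ y : L, A.mul x y ∈ I

/-- An ascending chain of ideals `⊥ = I 0 ≤ I 1 ≤ ⋯ ≤ I k = ⊤`
with `I (s+1) · L ⊆ I s`. -/
def CentralChain (A : SAAStruct F L) (I : ℕ → Submodule F L) (k : ℕ) : Prop :=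
  I 0 = ⊥ ∧ I k = ⊤ ∧ (∀ s, s < k → I s ≤ I (s + 1)) ∧
  (∀ s, s ≤ k → A.IsIdealSub (I s)) ∧
  (∀ s, s < k → ∀ x ∈ I (s + 1), ∀ y : L, A.mul x y ∈ I s)

/-- `A` is nilpotent if it admits a central chain of ideals. -/
def IsNilpotent (A : SAAStruct F L) : Prop :=
  ∃ (k : ℕ) (I : ℕ → Submodule F L), A.CentralChain I k

/-- The nilpotency class of `A`: the least length of a central chain of ideals. -/
noncomputable def nilClass (A : SAAStruct F L) : ℕ :=
  sInf {k | ∃ I : ℕ → Submodule F L, A.CentralChain I k}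

/-- The center `Z(L) = {x : x·L = 0}`. -/
def center (A : SAAStruct F L) : Submodule F L := LinearMap.ker A.mul

/-- The lower central series, indexed so that `lcs A i` is `L^(i+1)`:
`lcs A 0 = L¹ = L` and `lcs A (i+1) = L^(i+2) = span {u·v : u ∈ L^(i+1), v ∈ L}`. -/
def lcs (A : SAAStruct F L) : ℕ → Submodule F L
  | 0 => ⊤
  | (i + 1) => Submodule.span F {z | ∃ u ∈ A.lcs i, ∃ v : L, z = A.mul u v}

/-- The upper central series: `ucs A 0 = 0`, `ucs A (i+1) = {x : x·L ⊆ ucs A i}`. -/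
def ucs (A : SAAStruct F L) : ℕ → Submodule F L
  | 0 => ⊥
  | (i + 1) =>
    { carrier := {x | ∀ y : L, A.mul x y ∈ A.ucs i}
      add_mem' := by
        intro a b ha hb y
        simpa [map_add, LinearMap.add_apply] using
          Submodule.add_mem _ (ha y) (hb y)
      zero_mem' := by
        intro y
        simp
      smul_mem' := by
        intro c a ha y
        simpa [map_smul, LinearMap.smul_apply] using
          Submodule.smul_mem _ c (ha y) }

/-- The perp `U^⊥ = {x : (x,u) = 0 for all u ∈ U}` of a subspace with
respect to the alternating form of `A`. -/
def perp (A : SAAStruct F L) (U : Submodule F L) : Submodule F L :=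
  { carrier := {x | ∀ u ∈ U, A.form x u = 0}
    add_mem' := by
      intro a b ha hb u hu
      simp [map_add, LinearMap.add_apply, ha u hu, hb u hu]
    zero_mem' := by
      intro u hu
      simp
    smul_mem' := by
      intro c a ha u hu
      simp [map_smul, LinearMap.smul_apply, ha u hu] }

/-- A subspace is isotropic if the form vanishes identically on it. -/
def Isotropic (A : SAAStruct F L) (U : Submodule F L) : Prop :=
  ∀ u ∈ U, ∀ v ∈ U, A.form u v = 0

/-- A subspace is abelian if the product vanishes identically on it. -/
def AbelianSub (A : SAAStruct F L) (U : Submodule F L) : Prop :=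
  ∀ u ∈ U, ∀ v ∈ U, A.mul u v = 0

end SAAStruct

/-- The function `Ω` with `Ω 0 = 0` and `Ω (m+1) = 2 + C(Ω m, 2)`. -/
def OmegaFn : ℕ → ℕ
  | 0 => 0
  | (m + 1) => 2 + Nat.choose (OmegaFn m) 2

/-- The entries of the Gram matrix of a standard (symplectic) basis
`x₁, y₁, x₂, y₂, …` enumerated as `b 0 = x₁, b 1 = y₁, b 2 = x₂, …`. -/
def stdJ (F : Type*) [Field F] {N : ℕ} (i j : Fin N) : F :=
  if (i : ℕ) % 2 = 0 ∧ (j : ℕ) = (i : ℕ) + 1 then 1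
  else if (j : ℕ) % 2 = 0 ∧ (i : ℕ) = (j : ℕ) + 1 then -1
  else 0

namespace SAAStruct

variable {F : Type*} [Field F] {L : Type*} [AddCommGroup L] [Module F L]

theorem form_mul_right (A : SAAStruct F L) (x u y : L) :
    A.form x (A.mul u y) = A.form (A.mul x y) u := by
  have hmul : A.mul.IsAlt := A.mul_alt
  have hform : A.form.IsAlt := A.form_alt
  rw [A.cyclic, ← hmul.neg u y, LinearMap.map_neg₂, hform.neg]

/-- The upper central series consists of the perps of the lower central series. -/
theorem ucs_eq_perp_lcs (A : SAAStruct F L) (i : ℕ) : A.ucs i = A.perp (A.lcs i) := by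
  induction i with
  | zero =>
    refine (eq_bot_iff.2 fun x hx => ?_).symm
    exact A.form_nondegen x fun y => hx y Submodule.mem_top
  | succ i ih =>
    ext x
    constructor
    · intro hx z hz
      change ∀ y, A.mul x y ∈ A.ucs i at hx
      refine (Submodule.span_le (p := LinearMap.ker (A.form x))).2 ?_ hz
      rintro _ ⟨u, hu, y, rfl⟩
      have h := hx y
      rw [ih] at h
      exact (A.form_mul_right x u y).trans (h u hu)
    · intro hx y
      rw [ih]
      intro u hu
      rw [← A.form_mul_right]
      exact hx _ (Submodule.subset_span ⟨u, hu, y, rfl⟩)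

theorem finrank_perp [FiniteDimensional F L] (A : SAAStruct F L) (U : Submodule F L) :
    Module.finrank F (A.perp U) = Module.finrank F L - Module.finrank F U := by
  have hform : A.form.IsAlt := A.form_alt
  have hnondeg : LinearMap.BilinForm.Nondegenerate A.form :=
    hform.isRefl.nondegenerate_iff_separatingLeft.2 A.form_nondegen
  have hperp : A.perp U = LinearMap.BilinForm.orthogonal A.form U := by
    ext x
    exact forall₂_congr fun u _ => hform.isRefl.eq_iff
  rw [hperp, LinearMap.BilinForm.finrank_orthogonal hnondeg U]

theorem finrank_lcs_add_finrank_ucs [FiniteDimensional F L] (A : SAAStruct F L) (i : ℕ) :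
    Module.finrank F (A.lcs i) + Module.finrank F (A.ucs i) = Module.finrank F L := by
  rw [A.ucs_eq_perp_lcs, A.finrank_perp]
  exact Nat.add_sub_cancel' (A.lcs i).finrank_le

end SAAStruct

/-- for a nilpotent SAA, for every `i ≥ 1`,
`dim L^i − dim L^(i+1) = dim Z_i − dim Z_{i−1}`.
(Here `A.lcs (i-1) = L^i` and `A.ucs i = Z_i(L)`.) -/
theorem stmt5 (F : Type*) [Field F] (L : Type*) [AddCommGroup L] [Module F L]
    [FiniteDimensional F L] (A : SAAStruct F L) (hnil : A.IsNilpotent) :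
    ∀ i : ℕ, 1 ≤ i →
      (Module.finrank F (A.lcs (i - 1)) : ℤ) - Module.finrank F (A.lcs i) =
        (Module.finrank F (A.ucs i) : ℤ) - Module.finrank F (A.ucs (i - 1)) := by
  intro i _
  have h₁ := A.finrank_lcs_add_finrank_ucs (i - 1)
  have h₂ := A.finrank_lcs_add_finrank_ucs i
  omega
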